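/- Let A = S¹ × I be an annulus, let θ₁, …, θ_ℓ and σ₁, …, σ_ℓ be distinct points of S¹ with σ_i ≠ θ_j for all i, j, and let G be the graph whose vertices are all θ-multiarcs and all σ-multiarcs in A, with an edge between two multiarcs exactly when they are disjoint (including at their endpoints). If α and β are two θ-multiarcs such that there is a homotopy of A relative to the boundary taking α to β, then α and β lie in the same connected component of G. -/

import Mathlib

noncomputable section

open Set

/-- The circle, as `ℝ / ℤ`. -/
abbrev Circle1 := AddCircle (1 : ℝ)

/-- The annulus `A = S¹ × I`. -/
abbrev Annulus : Type := Circle1 × unitInterval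

/-- `s` is a proper essential simple arc in the annulus from `x` to `y`: the image of an
injective continuous map whose interior avoids the boundary `S¹ × {0,1}`. -/
def IsVertArcSet (x y : Annulus) (s : Set Annulus) : Prop :=
  ∃ f : C(unitInterval, Annulus), Function.Injective f ∧ Set.range f = s ∧
    f 0 = x ∧ f 1 = y ∧
    ∀ t : unitInterval, ((f t).2 = 0 ∨ (f t).2 = 1) → t = 0 ∨ t = 1

/-- A `θ`-multiarc: a collection of `ℓ` pairwise disjoint (including endpoints) proper
simple essential arcs, the `i`-th connecting `(θ i, 0)` to `(θ i, 1)`. -/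
def IsMultiarc {ℓ : ℕ} (θ : Fin ℓ → Circle1) (m : Fin ℓ → Set Annulus) : Prop :=
  (∀ i, IsVertArcSet (θ i, 0) (θ i, 1) (m i)) ∧
    Pairwise (Function.onFun Disjoint m)

/-- Vertices of the graph `G`: all `θ`-multiarcs and all `σ`-multiarcs. -/
def MultiVert {ℓ : ℕ} (θ σ : Fin ℓ → Circle1) : Type :=
  {m : Fin ℓ → Set Annulus // IsMultiarc θ m ∨ IsMultiarc σ m}

/-- The graph `G`: edges connect disjoint multiarcs (disjoint including endpoints). -/
def multiGraph {ℓ : ℕ} (θ σ : Fin ℓ → Circle1) : SimpleGraph (MultiVert θ σ) :=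
  SimpleGraph.fromRel fun m m' => Disjoint (⋃ i, m.val i) (⋃ i, m'.val i)

section Lifting

open scoped unitInterval

/-! ### Lifting and winding -/

lemma IsCoveringMap.exists_lift_square {E X : Type*} [TopologicalSpace E] [TopologicalSpace X]
    {p : E → X} (cov : IsCoveringMap p) (hp : Function.Surjective p) (F : C(I × I, X)) :
    ∃ L : C(I × I, E), ∀ q, p (L q) = F q := by
  obtain ⟨e, he⟩ := hp (F (0, 0))
  obtain ⟨Γ, hΓ, -⟩ := cov.exists_path_lifts (F.comp (.prodMk (.const I 0) (.id I))) e he.symm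
  have h0 : ∀ a, F (0, a) = p (Γ a) := fun a => (congrFun hΓ a).symm
  exact ⟨cov.liftHomotopy F Γ h0, fun q => congrFun (cov.liftHomotopy_lifts F Γ h0) q⟩

/-- A continuous logarithm along a path avoiding `0` in a half-plane whose rotation by `u` lies in
the closed right half-plane increases by the principal logarithm. -/
lemma log_lift_sub_eq {L c : I → ℂ} (hL : Continuous L) (hLc : ∀ t, Complex.exp (L t) = c t)
    (u : ℂ) (hu : u ≠ 0) (hre : ∀ t, 0 ≤ (u * c t).re) :
    L 1 - L 0 = Complex.log (u * c 1) - Complex.log (u * c 0) := by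
  have hc : Continuous c := by
    rw [← funext hLc]; exact Complex.continuous_exp.comp hL
  have hne : ∀ t, u * c t ≠ 0 := fun t => mul_ne_zero hu (hLc t ▸ Complex.exp_ne_zero _)
  have hslit : ∀ t, u * c t ∈ Complex.slitPlane := by
    intro t
    rw [Complex.mem_slitPlane_iff]
    rcases (hre t).lt_or_eq with h | h
    · exact .inl h
    · exact .inr fun him => hne t (Complex.ext h.symm him)
  have hcont : Continuous fun t => L t - Complex.log (u * c t) :=
    hL.sub ((continuous_const.mul hc).clog hslit)
  have key := Complex.isCoveringMap_exp.const_of_comp hcont (fun a a' => by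
    apply Subtype.ext
    simp only [Complex.exp_sub, Complex.exp_log (hne _), hLc]
    have h1 := hLc a ▸ Complex.exp_ne_zero (L a)
    have h2 := hLc a' ▸ Complex.exp_ne_zero (L a')
    field_simp) 1 0
  linear_combination key

/-- There is no nonvanishing map from the square to the plane which runs from the negative to the
positive real axis both above the origin (along bottom and right) and below it (along left and
top). -/
lemma square_map_has_zero (F : C(I × I, ℂ)) (hF : ∀ q, F q ≠ 0)
    (left : ∀ t, (F (0, t)).im ≤ 0) (top : ∀ s, (F (s, 1)).im ≤ 0)
    (bottom : ∀ s, 0 ≤ (F (s, 0)).im) (right : ∀ t, 0 ≤ (F (1, t)).im)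
    (h0 : (F (0, 0)).re < 0) (h1 : 0 < (F (1, 1)).re) : False := by
  obtain ⟨L, hL⟩ := Complex.isCoveringMap_exp.exists_lift_square
    (fun z => ⟨Complex.log z, Subtype.ext (Complex.exp_log z.2)⟩)
    ⟨fun q => ⟨F q, hF q⟩, by fun_prop⟩
  replace hL : ∀ q, Complex.exp (L q) = F q := fun q => congrArg Subtype.val (hL q)
  have e1 := log_lift_sub_eq (L := fun t => L (0, t)) (by fun_prop) (fun t => hL _) Complex.I
    Complex.I_ne_zero (fun t => by simpa using left t)
  have e2 := log_lift_sub_eq (L := fun t => L (t, 1)) (by fun_prop) (fun t => hL _) Complex.I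
    Complex.I_ne_zero (fun t => by simpa using top t)
  have e3 := log_lift_sub_eq (L := fun t => L (t, 0)) (by fun_prop) (fun t => hL _) (-Complex.I)
    (neg_ne_zero.2 Complex.I_ne_zero) (fun t => by simpa using bottom t)
  have e4 := log_lift_sub_eq (L := fun t => L (1, t)) (by fun_prop) (fun t => hL _) (-Complex.I)
    (neg_ne_zero.2 Complex.I_ne_zero) (fun t => by simpa using right t)
  have i0 : (F (0, 0)).im = 0 := le_antisymm (left 0) (bottom 0)
  have i1 : (F (1, 1)).im = 0 := le_antisymm (top 1) (right 1)
  have key : Complex.log (Complex.I * F (1, 1)) - Complex.log (Complex.I * F (0, 0)) =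
      Complex.log (-Complex.I * F (1, 1)) - Complex.log (-Complex.I * F (0, 0)) := by
    linear_combination e3 + e4 - e1 - e2
  have arg_pos : ∀ r : ℝ, 0 < r → (r * Complex.I).arg = Real.pi / 2 := fun r hr => by
    rw [Complex.arg_real_mul _ hr, Complex.arg_I]
  have arg_neg : ∀ r : ℝ, 0 < r → (r * -Complex.I).arg = -(Real.pi / 2) := fun r hr => by
    rw [Complex.arg_real_mul _ hr, Complex.arg_neg_I]
  have f0 : F (0, 0) = -((-(F (0, 0)).re : ℝ) : ℂ) := by
    apply Complex.ext <;> simp [i0]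
  have f1 : F (1, 1) = ((F (1, 1)).re : ℂ) := by
    apply Complex.ext <;> simp [i1]
  have g1 : (Complex.I * F (1, 1)).arg = Real.pi / 2 := by
    rw [f1, mul_comm]; exact arg_pos _ h1
  have g2 : (-Complex.I * F (1, 1)).arg = -(Real.pi / 2) := by
    rw [f1, mul_comm]; exact arg_neg _ h1
  have g3 : (Complex.I * F (0, 0)).arg = -(Real.pi / 2) := by
    rw [f0, mul_comm, neg_mul_comm]; exact arg_neg _ (neg_pos.2 h0)
  have g4 : (-Complex.I * F (0, 0)).arg = Real.pi / 2 := by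
    rw [f0, mul_comm, neg_mul_neg]; exact arg_pos _ (neg_pos.2 h0)
  have := congrArg Complex.im key
  simp only [Complex.sub_im, Complex.log_im, g1, g2, g3, g4] at this
  linarith [Real.pi_pos]

/-- Disjoint arcs across the annulus wind equally often; by symmetry it suffices to bound
one winding number by the other. -/
lemma winding_le_of_disjoint {f g : C(I, Annulus)} (hfg : ∀ s t, f s ≠ g t)
    (f0 : (f 0).2 = 0) (f1 : (f 1).2 = 1) (g0 : (g 0).2 = 0) (g1 : (g 1).2 = 1)
    {X Z : C(I, ℝ)} (hX : ∀ t, (X t : Circle1) = (f t).1) (hZ : ∀ t, (Z t : Circle1) = (g t).1)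
    {m n : ℤ} (hm : X 1 - X 0 = m) (hn : Z 1 - Z 0 = n) : m ≤ n := by
  by_contra! hlt
  have hlt' : (n : ℝ) + 1 ≤ m := by exact_mod_cast hlt
  set k : ℤ := ⌊X 0 - Z 0⌋ + 1 with hk
  have hk1 : X 0 - Z 0 < k := by rw [hk]; push_cast; exact Int.lt_floor_add_one _
  have hk2 : (k : ℝ) < X 0 - Z 0 + 1 := by
    rw [hk]; push_cast
    refine add_lt_add_left (lt_of_le_of_ne (Int.floor_le _) fun h => ?_) 1
    refine hfg 0 0 (Prod.ext ?_ (f0.trans g0.symm))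
    rw [← hX, ← hZ, ← sub_eq_zero, ← AddCircle.coe_sub, ← h]
    exact (AddCircle.coe_eq_zero_iff 1).2 ⟨⌊X 0 - Z 0⌋, by simp⟩
  refine square_map_has_zero
    ⟨fun q => ⟨X q.1 - Z q.2 - k, ((f q.1).2 : ℝ) - (g q.2).2⟩, ?_⟩ ?_ ?_ ?_ ?_ ?_ ?_ ?_
  · have : (fun q : I × I => (⟨X q.1 - Z q.2 - k, ((f q.1).2 : ℝ) - (g q.2).2⟩ : ℂ)) =
        fun q => ((X q.1 - Z q.2 - k : ℝ) : ℂ) +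
          ((((f q.1).2 : ℝ) - (g q.2).2 : ℝ) : ℂ) * Complex.I :=
      funext fun q => Complex.ext (by simp) (by simp)
    rw [this]; fun_prop
  · rintro ⟨s, t⟩ h
    refine hfg s t (Prod.ext ?_ (Subtype.ext (sub_eq_zero.1 (congrArg Complex.im h))))
    have := congrArg Complex.re h
    simp only [ContinuousMap.coe_mk, Complex.zero_re] at this
    rw [← hX, ← hZ, ← sub_eq_zero, ← AddCircle.coe_sub]
    exact (AddCircle.coe_eq_zero_iff 1).2 ⟨k, by simp; linarith⟩
  · intro t; simpa [f0] using (g t).2.2.1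
  · intro t; simpa [g1] using (f t).2.2.2
  · intro t; simpa [g0] using (f t).2.2.1
  · intro t; simpa [f1] using (g t).2.2.2
  · simp; linarith
  · simp; linarith

/-! ### Simple arcs in open subsets of normed spaces -/

section Arcs

variable {E : Type*}

/-- `x` and `y` are the ends of a (possibly degenerate) simple arc contained in `S`. -/
def ArcIn [TopologicalSpace E] (S : Set E) (x y : E) : Prop :=
  ∃ (a b : ℝ) (f : ℝ → E), a ≤ b ∧ ContinuousOn f (Icc a b) ∧ InjOn f (Icc a b) ∧
    MapsTo f (Icc a b) S ∧ f a = x ∧ f b = y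

lemma ArcIn.refl [TopologicalSpace E] {S : Set E} {x : E} (hx : x ∈ S) : ArcIn S x x :=
  ⟨0, 0, fun _ => x, le_rfl, continuousOn_const, by simp [InjOn], fun _ _ => hx, rfl, rfl⟩

lemma ArcIn.symm [TopologicalSpace E] {S : Set E} {x y : E} : ArcIn S x y → ArcIn S y x := by
  rintro ⟨a, b, f, hab, hc, hi, hm, ha, hb⟩
  have hneg : MapsTo (fun t : ℝ => -t) (Icc (-b) (-a)) (Icc a b) := fun t ht =>
    ⟨by linarith [ht.2], by linarith [ht.1]⟩
  exact ⟨-b, -a, fun t => f (-t), by linarith, hc.comp continuous_neg.continuousOn hneg,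
    hi.comp neg_injective.injOn hneg, hm.comp hneg, by simpa, by simpa⟩

lemma ArcIn.mem_right [TopologicalSpace E] {S : Set E} {x y : E} : ArcIn S x y → y ∈ S := by
  rintro ⟨a, b, f, hab, -, -, hm, -, rfl⟩
  exact hm (right_mem_Icc.2 hab)

variable [NormedAddCommGroup E] [NormedSpace ℝ E]

/-- A simple arc can be prolonged by a segment, after cutting off a final piece of the arc. -/
lemma ArcIn.append_segment {S S' : Set E} {x p q : E} (h : ArcIn S x p)
    (hseg : segment ℝ p q ⊆ S') : ArcIn (S ∪ S') x q := by
  obtain ⟨a, b, f, hab, hc, hi, hm, ha, hb⟩ := h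
  rcases eq_or_ne p q with rfl | hpq
  · exact ⟨a, b, f, hab, hc, hi, fun t ht => .inl (hm ht), ha, hb⟩
  have hl : Continuous (AffineMap.lineMap p q : ℝ → E) := AffineMap.lineMap_continuous
  have hcomp : IsCompact (Icc (0 : ℝ) 1 ∩ AffineMap.lineMap p q ⁻¹' (f '' Icc a b)) :=
    isCompact_Icc.inter_right ((isCompact_Icc.image_of_continuousOn hc).isClosed.preimage hl)
  obtain ⟨τ, ⟨⟨hτ0, hτ1⟩, s, hs, hfs⟩, hmax⟩ := hcomp.exists_isGreatest
    ⟨0, by simp, b, by simp [hab], by simp [hb]⟩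
  have hlate : ∀ r ∈ Icc (0 : ℝ) 1, τ < r → ∀ t ∈ Icc a b, f t ≠ AffineMap.lineMap p q r :=
    fun r hr hlt t ht heq => hlt.not_ge (hmax ⟨hr, t, ht, heq⟩)
  have hsub : Icc a s ⊆ Icc a b := Icc_subset_Icc_right hs.2
  have htail : ∀ t ∈ Icc s (s + (1 - τ)), τ + (t - s) ∈ Icc (0 : ℝ) 1 := fun t ht =>
    ⟨by linarith [ht.1], by linarith [ht.2]⟩
  set g : ℝ → E := fun t => if t ≤ s then f t else AffineMap.lineMap p q (τ + (t - s)) with hg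
  have g1 : ∀ t ≤ s, g t = f t := fun t ht => if_pos ht
  have g2 : ∀ t, s < t → g t = AffineMap.lineMap p q (τ + (t - s)) := fun t ht =>
    if_neg ht.not_ge
  have g2' : ∀ t, s ≤ t → g t = AffineMap.lineMap p q (τ + (t - s)) := by
    intro t ht
    rcases ht.eq_or_lt with rfl | ht
    · rw [g1 _ le_rfl, hfs, sub_self, add_zero]
    · exact g2 t ht
  have hne : ∀ t ∈ Icc a s, ∀ r ∈ Icc s (s + (1 - τ)), s < r → g t ≠ g r := by
    intro t ht r hr hlt
    rw [g1 t ht.2, g2 r hlt]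
    exact hlate _ (htail r hr) (by linarith) t (hsub ht)
  refine ⟨a, s + (1 - τ), g, by linarith [hs.1], ?_, ?_, ?_, by rw [g1 _ hs.1, ha], ?_⟩
  · rw [← Icc_union_Icc_eq_Icc hs.1 (by linarith : s ≤ s + (1 - τ))]
    refine ContinuousOn.union_of_isClosed ((hc.mono hsub).congr fun t ht => g1 t ht.2)
      (ContinuousOn.congr ?_ fun t ht => g2' t ht.1) isClosed_Icc isClosed_Icc
    exact (hl.comp (by fun_prop)).continuousOn
  · intro t ht r hr htr
    rcases le_or_gt t s with h1 | h1 <;> rcases le_or_gt r s with h2 | h2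
    · rw [g1 t h1, g1 r h2] at htr
      exact hi (hsub ⟨ht.1, h1⟩) (hsub ⟨hr.1, h2⟩) htr
    · exact absurd htr (hne t ⟨ht.1, h1⟩ r ⟨h2.le, hr.2⟩ h2)
    · exact absurd htr.symm (hne r ⟨hr.1, h2⟩ t ⟨h1.le, ht.2⟩ h1)
    · rw [g2 t h1, g2 r h2] at htr
      have := AffineMap.lineMap_injective ℝ hpq htr
      linarith
  · intro t ht
    rcases le_or_gt t s with h1 | h1
    · rw [g1 t h1]; exact .inl (hm (hsub ⟨ht.1, h1⟩))
    · rw [g2 t h1]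
      refine .inr (hseg ?_)
      rw [segment_eq_image_lineMap]
      exact ⟨_, htail t ⟨h1.le, ht.2⟩, rfl⟩
  · rw [g2' _ (by linarith)]; simp

lemma ArcIn.trans_segment {S : Set E} {x p q : E} (h : ArcIn S x p)
    (hseg : segment ℝ p q ⊆ S) : ArcIn S x q := by
  simpa using h.append_segment hseg

lemma isOpen_setOf_arcIn {S : Set E} (hS : IsOpen S) (x : E) : IsOpen {y | ArcIn S x y} := by
  refine Metric.isOpen_iff.2 fun y hy => ?_
  obtain ⟨r, hr, hball⟩ := Metric.isOpen_iff.1 hS y hy.mem_right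
  exact ⟨r, hr, fun z hz => hy.trans_segment
    (((convex_ball y r).segment_subset (Metric.mem_ball_self hr) hz).trans hball)⟩

lemma isOpen_setOf_not_arcIn {S : Set E} (hS : IsOpen S) (x : E) :
    IsOpen {y | y ∈ S ∧ ¬ ArcIn S x y} := by
  refine Metric.isOpen_iff.2 fun y hy => ?_
  obtain ⟨r, hr, hball⟩ := Metric.isOpen_iff.1 hS y hy.1
  exact ⟨r, hr, fun z hz => ⟨hball hz, fun h => hy.2 (h.trans_segment
    (((convex_ball y r).segment_subset hz (Metric.mem_ball_self hr)).trans hball))⟩⟩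

end Arcs

/-! ### Arcs along level sets -/

/-- If `U` is uniformly close to the first coordinate up to bounded error, nearly equal to it at
height `y₀` and nearly equal to a translate at height `y₁`, then every open neighbourhood
`|U - c| < ε` of a level set contains an arc between these heights. -/
lemma exists_arcIn_level {U : ℝ × ℝ → ℝ} (hU : Continuous U) {b c ε M y₀ y₁ : ℝ} (hε : 0 < ε)
    (hy₀ : 0 < y₀) (hy : y₀ < y₁) (hy₁ : y₁ < 1) (hM : ∀ q, |U q - q.1| ≤ M)
    (hbot : ∀ x, |U (x, y₀) - x| < ε / 8) (htop : ∀ x, |U (x, y₁) - (x + b)| < ε / 8) :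
    ArcIn {q | |U q - c| < ε ∧ 0 < q.2 ∧ q.2 < 1} (c, y₀) (c - b, y₁) := by
  set O : Set (ℝ × ℝ) := {q | |U q - c| < ε ∧ 0 < q.2 ∧ q.2 < 1} with hO
  have hOo : IsOpen O := by
    have h1 : IsOpen {q : ℝ × ℝ | |U q - c| < ε} := isOpen_lt (by fun_prop) continuous_const
    exact h1.inter ((isOpen_lt continuous_const continuous_snd).inter
      (isOpen_lt continuous_snd continuous_const))
  by_contra hnot
  have near_bot : ∀ x, |U (x, y₀) - c| < ε / 2 → ArcIn O (c, y₀) (x, y₀) := by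
    intro x hx
    have hsub : segment ℝ (c, y₀) (x, y₀) ⊆ O := by
      have hconv : Convex ℝ (Metric.ball c (ε / 2 + ε / 8) ×ˢ ({y₀} : Set ℝ)) :=
        (convex_ball _ _).prod (convex_singleton _)
      refine (hconv.segment_subset ⟨Metric.mem_ball_self (by linarith), mem_singleton _⟩
        ⟨?_, mem_singleton _⟩).trans ?_
      · rw [Metric.mem_ball, Real.dist_eq]
        have := hbot x
        rw [abs_lt] at *; constructor <;> linarith
      · rintro ⟨x', y'⟩ ⟨h1, rfl⟩
        refine ⟨?_, hy₀, hy.trans hy₁⟩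
        rw [Metric.mem_ball, Real.dist_eq] at h1
        have := hbot x'
        dsimp only at *
        rw [abs_lt] at *; constructor <;> linarith
    exact (ArcIn.refl (hsub (left_mem_segment _ _ _))).trans_segment hsub
  have near_top : ∀ x, |U (x, y₁) - c| < ε / 2 → ¬ ArcIn O (c, y₀) (x, y₁) := by
    intro x hx hT
    refine hnot (hT.trans_segment ?_)
    have hconv : Convex ℝ (Metric.ball (c - b) (ε / 2 + ε / 8) ×ˢ ({y₁} : Set ℝ)) :=
      (convex_ball _ _).prod (convex_singleton _)
    refine (hconv.segment_subset ⟨?_, mem_singleton _⟩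
      ⟨Metric.mem_ball_self (by linarith), mem_singleton _⟩).trans ?_
    · rw [Metric.mem_ball, Real.dist_eq]
      have := htop x
      rw [abs_lt] at *; constructor <;> linarith
    · rintro ⟨x', y'⟩ ⟨h1, rfl⟩
      refine ⟨?_, hy₀.trans hy, hy₁⟩
      rw [Metric.mem_ball, Real.dist_eq] at h1
      have := htop x'
      dsimp only at *
      rw [abs_lt] at *; constructor <;> linarith
  classical
  set G : ℝ × ℝ → ℝ := fun q => max 0 (ε / 2 - |U q - c|) with hG
  have hGc : Continuous G := by fun_prop
  have hG0 : ∀ q, 0 ≤ G q := fun q => le_max_left _ _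
  have hGz : ∀ q, ε / 2 ≤ |U q - c| → G q = 0 := fun q h => max_eq_left (by linarith)
  set h : ℝ × ℝ → ℝ := fun q => if ArcIn O (c, y₀) q then G q else -G q with hh
  have hz : ∀ q, ε / 2 ≤ |U q - c| → h q = 0 := fun q hq => by simp [hh, hGz q hq]
  have hcont : ∀ q : ℝ × ℝ, 0 < q.2 → q.2 < 1 → ContinuousAt h q := by
    intro q hq0 hq1
    by_cases hqO : q ∈ O
    · by_cases hqT : ArcIn O (c, y₀) q
      · refine hGc.continuousAt.congr ?_
        filter_upwards [(isOpen_setOf_arcIn hOo _).mem_nhds hqT] with z hz'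
        exact (if_pos hz').symm
      · refine hGc.neg.continuousAt.congr ?_
        filter_upwards [(isOpen_setOf_not_arcIn hOo _).mem_nhds ⟨hqO, hqT⟩] with z hz'
        exact (if_neg hz'.2).symm
    · have hge : ε ≤ |U q - c| := not_lt.1 fun hlt => hqO ⟨hlt, hq0, hq1⟩
      have hopen : IsOpen {z | ε / 2 < |U z - c|} := isOpen_lt (by fun_prop) (by fun_prop)
      refine (continuousAt_const (y := (0 : ℝ))).congr ?_
      filter_upwards [hopen.mem_nhds (show ε / 2 < |U q - c| by linarith)] with z hz'
      exact (hz z hz'.le).symm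
  set R : ℝ := M + |c| + ε with hR
  set γ : I × I → ℝ × ℝ := fun q => (-R + 2 * R * q.1, y₀ + (y₁ - y₀) * q.2) with hγ
  have hγc : Continuous γ := by fun_prop
  have hγ2 : ∀ q, 0 < (γ q).2 ∧ (γ q).2 < 1 := by
    intro q
    have h0 := q.2.2.1
    have h1 := q.2.2.2
    simp only [hγ]
    constructor <;> nlinarith
  have hleft : ∀ y, U (-R, y) - c ≤ -ε := fun y => by
    have := (abs_le.1 (hM (-R, y))).2
    have := neg_abs_le c
    dsimp only at *
    linarith
  have hright : ∀ y, ε ≤ U (R, y) - c := fun y => by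
    have := (abs_le.1 (hM (R, y))).1
    have := le_abs_self c
    dsimp only at *
    linarith
  have hhγ : Continuous fun q => h (γ q) := continuous_iff_continuousAt.2 fun q =>
    (hcont _ (hγ2 q).1 (hγ2 q).2).comp hγc.continuousAt
  have hγ0 : ∀ t, γ (0, t) = (-R, y₀ + (y₁ - y₀) * t) := fun t => by simp [hγ]
  have hγ1 : ∀ t, γ (1, t) = (R, y₀ + (y₁ - y₀) * t) := fun t => by
    simp only [hγ, Icc.coe_one]; ring_nf
  refine square_map_has_zero ⟨fun q => ⟨U (γ q) - c, h (γ q)⟩, ?_⟩ ?_ ?_ ?_ ?_ ?_ ?_ ?_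
  · have : (fun q : I × I => (⟨U (γ q) - c, h (γ q)⟩ : ℂ)) =
        fun q => ((U (γ q) - c : ℝ) : ℂ) + (h (γ q) : ℂ) * Complex.I :=
      funext fun q => Complex.ext (by simp) (by simp)
    rw [this]
    exact (Complex.continuous_ofReal.comp ((hU.comp hγc).sub continuous_const)).add
      ((Complex.continuous_ofReal.comp hhγ).mul continuous_const)
  · intro q hq
    have h1 : U (γ q) - c = 0 := congrArg Complex.re hq
    have h2 : h (γ q) = 0 := congrArg Complex.im hq
    have h3 : G (γ q) = ε / 2 := by simp [hG, h1, (half_pos hε).le]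
    simp only [hh, h3] at h2
    split_ifs at h2 <;> linarith
  · intro t
    refine (hz _ ?_).le
    rw [hγ0, abs_of_neg] <;> linarith [hleft (y₀ + (y₁ - y₀) * t)]
  · intro s
    change h (γ (s, 1)) ≤ 0
    have e : γ (s, 1) = (-R + 2 * R * s, y₁) := by simp [hγ]
    rw [e]
    rcases lt_or_ge (|U (-R + 2 * R * s, y₁) - c|) (ε / 2) with hlt | hge
    · rw [hh]; simpa [near_top _ hlt] using hG0 _
    · exact (hz _ hge).le
  · intro s
    change 0 ≤ h (γ (s, 0))
    have e : γ (s, 0) = (-R + 2 * R * s, y₀) := by simp [hγ]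
    rw [e]
    rcases lt_or_ge (|U (-R + 2 * R * s, y₀) - c|) (ε / 2) with hlt | hge
    · rw [hh]; simpa [near_bot _ hlt] using hG0 _
    · exact (hz _ hge).ge
  · intro t
    refine (hz _ ?_).ge
    rw [hγ1, abs_of_pos] <;> linarith [hright (y₀ + (y₁ - y₀) * t)]
  · change U (γ (0, 0)) - c < 0
    rw [hγ0]; exact (hleft _).trans_lt (by linarith)
  · change 0 < U (γ (1, 1)) - c
    rw [hγ1]; exact lt_of_lt_of_le hε (hright _)

/-- The universal covering of the annulus, extended constantly beyond the strip. -/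
def stripProj (q : ℝ × ℝ) : Annulus := (q.1, projIcc 0 1 zero_le_one q.2)

lemma continuous_stripProj : Continuous stripProj :=
  ((AddCircle.continuous_mk' 1).comp continuous_fst).prodMk
    (continuous_projIcc.comp continuous_snd)

lemma circle1_coe_int (n : ℤ) : (((n : ℝ)) : Circle1) = 0 :=
  (AddCircle.coe_eq_zero_iff 1).2 ⟨n, by simp⟩

lemma circle1_norm_coe_le (x : ℝ) : ‖(x : Circle1)‖ ≤ |x| :=
  QuotientAddGroup.norm_mk_le_norm

/-- If `w` is constant with integer values on both boundary circles, then every open neighbourhood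
of a fibre of `p ↦ p.1 + w p` contains a vertical arc. -/
lemma exists_isVertArcSet (w : C(Annulus, ℝ)) {b : ℤ} (h0 : ∀ z, w (z, 0) = 0)
    (h1 : ∀ z, w (z, 1) = b) (c : Circle1) {ε : ℝ} (hε : 0 < ε) :
    ∃ s, IsVertArcSet (c, 0) (c, 1) s ∧ ∀ p ∈ s, ‖p.1 + (w p : Circle1) - c‖ < ε := by
  wlog hε2 : ε ≤ 1 / 2 generalizing ε
  · obtain ⟨s, hs, hs'⟩ := this (ε := 1 / 2) (by norm_num) le_rfl
    exact ⟨s, hs, fun p hp => (hs' p hp).trans (not_le.1 hε2)⟩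
  obtain ⟨c, rfl⟩ := QuotientAddGroup.mk_surjective c
  set U : ℝ × ℝ → ℝ := fun q => q.1 + w (stripProj q) with hU
  have hUc : Continuous U := continuous_fst.add (w.continuous.comp continuous_stripProj)
  obtain ⟨δ, hδ, hw⟩ := Metric.uniformContinuous_iff.1
    (CompactSpace.uniformContinuous_of_continuous w.continuous) (ε / 8) (by linarith)
  obtain ⟨y₀, hy₀, hyδ, hy4⟩ : ∃ y₀ : ℝ, 0 < y₀ ∧ y₀ < δ ∧ y₀ < 1 / 2 := by
    refine ⟨min δ (1 / 2) / 2, by positivity, ?_, ?_⟩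
    · linarith [min_le_left δ (1 / 2)]
    · linarith [min_le_right δ (1 / 2)]
  have hbot : ∀ x y, 0 ≤ y → y ≤ y₀ → |U (x, y) - x| < ε / 8 := by
    intro x y h2 h3
    have := @hw (stripProj (x, y)) ((x : Circle1), 0) (by
      rw [stripProj, projIcc_of_mem _ ⟨h2, by linarith⟩, Prod.dist_eq, dist_self, Subtype.dist_eq,
        Real.dist_eq]
      refine max_lt hδ ?_
      simpa [abs_of_nonneg h2] using h3.trans_lt hyδ)
    rw [h0, Real.dist_eq] at this
    simpa [hU] using this
  have htop : ∀ x y, 1 - y₀ ≤ y → y ≤ 1 → |U (x, y) - (x + b)| < ε / 8 := by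
    intro x y h2 h3
    have := @hw (stripProj (x, y)) ((x : Circle1), 1) (by
      rw [stripProj, projIcc_of_mem _ ⟨by linarith, h3⟩, Prod.dist_eq, dist_self, Subtype.dist_eq,
        Real.dist_eq]
      refine max_lt hδ ?_
      simp only [Icc.coe_one]
      rw [abs_sub_comm, abs_of_nonneg (by linarith)]
      linarith)
    rw [h1, Real.dist_eq] at this
    simpa [hU] using this
  have hM : ∀ q, |U q - q.1| ≤ ‖w‖ := fun q => by
    simpa [hU] using w.norm_coe_le_norm (stripProj q)
  have harc := exists_arcIn_level (c := c) hUc hε hy₀ (by linarith : y₀ < 1 - y₀) (by linarith) hM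
    (fun x => hbot x y₀ hy₀.le le_rfl) (fun x => htop x _ le_rfl (by linarith))
  set W : Set (ℝ × ℝ) := {q | |U q - c| < ε ∧ q.2 ∈ Icc (0 : ℝ) 1 ∧ (q.2 = 0 → q = (c, 0)) ∧
    (q.2 = 1 → q = (c - b, 1))} with hW
  have hOW : {q : ℝ × ℝ | |U q - c| < ε ∧ 0 < q.2 ∧ q.2 < 1} ⊆ W := fun q ⟨q1, q2, q3⟩ =>
    ⟨q1, ⟨q2.le, q3.le⟩, fun h => absurd h q2.ne', fun h => absurd h q3.ne⟩
  have hsegTop : segment ℝ (c - b, 1 - y₀) (c - b, 1) ⊆ W := by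
    have hconv : Convex ℝ (({c - b} : Set ℝ) ×ˢ Icc (1 - y₀) 1) :=
      (convex_singleton _).prod (convex_Icc _ _)
    refine (hconv.segment_subset ⟨mem_singleton _, by simp [hy₀.le]⟩
      ⟨mem_singleton _, by simp [hy₀.le]⟩).trans ?_
    rintro ⟨x, y⟩ ⟨hx, h2, h3⟩
    obtain rfl : x = c - b := hx
    dsimp only at h2 h3
    refine ⟨?_, ⟨by dsimp only; linarith, h3⟩, fun h => ?_, fun h => ?_⟩
    · have := htop (c - b) y h2 h3
      rw [sub_add_cancel] at this
      linarith
    · dsimp only at h; linarith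
    · exact Prod.ext rfl h
  have hsegBot : segment ℝ (c, y₀) (c, 0) ⊆ W := by
    have hconv : Convex ℝ (({c} : Set ℝ) ×ˢ Icc 0 y₀) :=
      (convex_singleton _).prod (convex_Icc _ _)
    refine (hconv.segment_subset ⟨mem_singleton _, by simp [hy₀.le]⟩
      ⟨mem_singleton _, by simp [hy₀.le]⟩).trans ?_
    rintro ⟨x, y⟩ ⟨hx, h2, h3⟩
    obtain rfl : x = c := hx
    dsimp only at h2 h3
    refine ⟨?_, ⟨h2, by dsimp only; linarith⟩, fun h => ?_, fun h => ?_⟩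
    · linarith [hbot x y h2 h3]
    · exact Prod.ext rfl h
    · dsimp only at h; linarith
  have hW' : ArcIn (W ∪ W ∪ W) (c, 0) (c - b, 1) := by
    refine ArcIn.symm (ArcIn.append_segment (ArcIn.symm (ArcIn.append_segment ?_ hsegTop)) hsegBot)
    obtain ⟨a, d, f, hf⟩ := harc
    exact ⟨a, d, f, hf.1, hf.2.1, hf.2.2.1, hf.2.2.2.1.mono_right hOW, hf.2.2.2.2⟩
  rw [union_self, union_self] at hW'
  obtain ⟨a, d, f, had, hfc, hfi, hfW, hfa, hfd⟩ := hW'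
  have had' : a < d := by
    refine lt_of_le_of_ne had ?_
    rintro rfl
    have := congrArg Prod.snd (hfa.symm.trans hfd)
    simp at this
  have hmem : ∀ t : I, a + (d - a) * t ∈ Icc a d := fun t => by
    have := t.2.1
    have := t.2.2
    constructor <;> nlinarith
  set φ : I → ℝ × ℝ := fun t => f (a + (d - a) * t) with hφ
  have hφc : Continuous φ := hfc.comp_continuous (by fun_prop) hmem
  have hφW : ∀ t, φ t ∈ W := fun t => hfW (hmem t)
  have hφi : Function.Injective φ := fun s t hst => by
    have := hfi (hmem s) (hmem t) hst
    exact Subtype.ext (mul_left_cancel₀ (sub_pos.2 had').ne' (add_left_cancel this))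
  have hsnd : ∀ t, ((stripProj (φ t)).2 : ℝ) = (φ t).2 := fun t => by
    rw [stripProj, projIcc_of_mem _ (hφW t).2.1]
  have hφ0 : φ 0 = (c, 0) := by simp [hφ, hfa]
  have hφ1 : φ 1 = (c - b, 1) := by simp [hφ, hfd]
  refine ⟨_, ⟨⟨fun t => stripProj (φ t), continuous_stripProj.comp hφc⟩, ?_, rfl, ?_, ?_, ?_⟩, ?_⟩
  · intro s t hst
    dsimp only [ContinuousMap.coe_mk] at hst
    have e2 : (φ s).2 = (φ t).2 := by rw [← hsnd, ← hsnd, hst]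
    have e1 : (((φ s).1 - (φ t).1 : ℝ) : Circle1) = 0 := by
      rw [AddCircle.coe_sub, sub_eq_zero]; exact congrArg Prod.fst hst
    obtain ⟨n, hn⟩ := (AddCircle.coe_eq_zero_iff 1).1 e1
    have eU : U (φ s) - U (φ t) = n := by simp [hU, hst, ← hn]
    have hlt : |(n : ℝ)| < 1 := by
      rw [← eU]
      have hs := (hφW s).1
      have ht := (hφW t).1
      rw [abs_lt] at *; constructor <;> linarith
    obtain rfl : n = 0 := Int.abs_lt_one_iff.1 (by exact_mod_cast hlt)
    exact hφi (Prod.ext (by simpa [sub_eq_zero, eq_comm] using hn) e2)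
  · simp [hφ0, stripProj]
  · simp [hφ1, stripProj, circle1_coe_int]
  · intro t ht
    dsimp only [ContinuousMap.coe_mk] at ht
    rcases ht with ht | ht
    · left
      refine hφi (((hφW t).2.2.1 ?_).trans hφ0.symm)
      rw [← hsnd, ht]; rfl
    · right
      refine hφi (((hφW t).2.2.2 ?_).trans hφ1.symm)
      rw [← hsnd, ht]; rfl
  · rintro _ ⟨t, rfl⟩
    have : ((stripProj (φ t)).1 + (w (stripProj (φ t)) : Circle1) - (c : Circle1)) =
        ((U (φ t) - c : ℝ) : Circle1) := by
      simp [hU, stripProj]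
    exact (this ▸ circle1_norm_coe_le _).trans_lt (hφW t).1

theorem exists_extension_along {Y A : Type*} [TopologicalSpace Y] [CompactSpace Y]
    [TopologicalSpace A] [T2Space A] [NormalSpace A] (φ : C(Y, A)) (ψ : C(Y, ℝ))
    (h : ∀ a b, φ a = φ b → ψ a = ψ b) : ∃ w : C(A, ℝ), ∀ y, w (φ y) = ψ y := by
  let q : C(Y, range φ) := ⟨rangeFactorization φ, φ.continuous.subtype_mk _⟩
  have hq : Topology.IsQuotientMap q :=
    q.continuous.isClosedMap.isQuotientMap q.continuous rangeFactorization_surjective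
  have hfac : Function.FactorsThrough ψ q := fun a b hab => h a b (congrArg Subtype.val hab)
  obtain ⟨w, hw⟩ := ContinuousMap.exists_restrict_eq (isCompact_range φ.continuous).isClosed
    (hq.lift ψ hfac)
  refine ⟨w, fun y => ?_⟩
  have h1 := DFunLike.congr_fun hw (q y)
  have h2 := DFunLike.congr_fun (hq.lift_comp ψ hfac) y
  exact h1.trans h2

theorem eq_of_coe_mem_finite (g : C(I, ℝ)) {S : Set Circle1} (hS : S.Finite)
    (hg : ∀ t, (g t : Circle1) ∈ S) (s t : I) : g s = g t := by
  have hc : Continuous fun t => (g t : Circle1) :=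
    (AddCircle.continuous_mk' 1).comp g.continuous
  have hsub : (range fun t => (g t : Circle1)).Subsingleton := by
    by_contra hn
    exact (isPreconnected_range hc).infinite_of_nontrivial (not_subsingleton_iff.1 hn)
      (hS.subset (range_subset_iff.2 hg))
  exact (AddCircle.isCoveringMap_coe 1).const_of_comp g.continuous
    (fun a a' => hsub (mem_range_self a) (mem_range_self a')) s t

theorem exists_lift_path (γ : C(I, Circle1)) : ∃ X : C(I, ℝ), ∀ t, (X t : Circle1) = γ t := by
  obtain ⟨x, hx⟩ := QuotientAddGroup.mk_surjective (γ 0)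
  obtain ⟨X, hX, -⟩ := (AddCircle.isCoveringMap_coe 1).exists_path_lifts γ x hx.symm
  exact ⟨X, fun t => congrFun hX t⟩

theorem exists_int_of_coe_eq {x y : ℝ} (h : (x : Circle1) = y) : ∃ n : ℤ, x - y = n := by
  have h0 : ((x - y : ℝ) : Circle1) = 0 := by rw [AddCircle.coe_sub, h, sub_self]
  obtain ⟨n, hn⟩ := (AddCircle.coe_eq_zero_iff 1).1 h0
  exact ⟨n, by rw [← hn]; simp⟩

/-- A multiarc is contained in the level sets of `p ↦ p.1 + w p` for a real function `w` vanishing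
on the inner boundary circle and equal to a constant integer on the outer one. -/
theorem IsMultiarc.exists_potential {ℓ : ℕ} {θ : Fin ℓ → Circle1} {m : Fin ℓ → Set Annulus}
    (hm : IsMultiarc θ m) (i₀ : Fin ℓ) :
    ∃ (w : C(Annulus, ℝ)) (b : ℤ), (∀ z, w (z, 0) = 0) ∧ (∀ z, w (z, 1) = b) ∧
      ∀ i, ∀ p ∈ m i, p.1 + (w p : Circle1) = θ i := by
  obtain ⟨harc, hdisj⟩ := hm
  choose f hinj hrange hf0 hf1 hbd using harc
  choose X hX using fun i => exists_lift_path ⟨fun t => (f i t).1, (f i).continuous.fst⟩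
  replace hX : ∀ i t, (X i t : Circle1) = (f i t).1 := hX
  choose n hn using fun i => exists_int_of_coe_eq
    (x := X i 1) (y := X i 0) (by rw [hX, hX, hf0, hf1])
  have hne : ∀ i j, i ≠ j → ∀ s t, f i s ≠ f j t := fun i j hij s t h =>
    disjoint_left.1 (hdisj hij) (hrange i ▸ mem_range_self s)
      (hrange j ▸ (h ▸ mem_range_self t : f i s ∈ range (f j)))
  have hle : ∀ i j, n i ≤ n j := fun i j => by
    rcases eq_or_ne i j with rfl | hij
    · exact le_rfl
    · exact winding_le_of_disjoint (hne i j hij) (by rw [hf0]) (by rw [hf1]) (by rw [hf0])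
        (by rw [hf1]) (hX i) (hX j) (hn i) (hn j)
  let φ : C((Fin ℓ × I) ⊕ (Circle1 ⊕ Circle1), Annulus) :=
    ⟨Sum.elim (fun y => f y.1 y.2) (Sum.elim (fun z => (z, 0)) fun z => (z, 1)), by
      refine Continuous.sumElim (continuous_prod_of_discrete_left.2 fun i => (f i).continuous)
        (Continuous.sumElim ?_ ?_) <;> fun_prop⟩
  let ψ : C((Fin ℓ × I) ⊕ (Circle1 ⊕ Circle1), ℝ) :=
    ⟨Sum.elim (fun y => X y.1 0 - X y.1 y.2)
      (Sum.elim (fun _ => 0) fun _ => ((-n i₀ : ℤ) : ℝ)), by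
      refine Continuous.sumElim (continuous_prod_of_discrete_left.2 fun i => ?_)
        (Continuous.sumElim ?_ ?_) <;> fun_prop⟩
  have hbot : ∀ i s, (f i s).2 = 0 → X i 0 - X i s = 0 := fun i s h => by
    rcases hbd i s (Or.inl h) with rfl | rfl
    · exact sub_self _
    · simp [hf1] at h
  have htop : ∀ i s, (f i s).2 = 1 → X i 0 - X i s = ((-n i₀ : ℤ) : ℝ) := fun i s h => by
    rcases hbd i s (Or.inr h) with rfl | rfl
    · simp [hf0] at h
    · rw [le_antisymm (hle i₀ i) (hle i i₀), Int.cast_neg, ← hn i]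
      ring
  obtain ⟨w, hw⟩ := exists_extension_along φ ψ (by
    rintro (⟨i, s⟩ | z | z) (⟨j, t⟩ | z' | z') h
    · have hij : i = j := by
        by_contra hij
        exact hne i j hij s t h
      subst hij
      rw [hinj i (show f i s = f i t from h)]
    · exact hbot i s (congrArg Prod.snd h)
    · exact htop i s (congrArg Prod.snd h)
    · exact (hbot j t (congrArg Prod.snd h).symm).symm
    · rfl
    · exact absurd (congrArg Prod.snd h) zero_ne_one
    · exact (htop j t (congrArg Prod.snd h).symm).symm
    · exact absurd (congrArg Prod.snd h) one_ne_zero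
    · rfl)
  refine ⟨w, -n i₀, fun z => hw (.inr (.inl z)), fun z => hw (.inr (.inr z)), fun i p hp => ?_⟩
  rw [← hrange i] at hp
  obtain ⟨t, rfl⟩ := hp
  rw [show w (f i t) = X i 0 - X i t from hw (.inl (i, t)), ← hX i t, ← AddCircle.coe_add,
    add_sub_cancel, hX i 0, hf0]

/-- A homotopy relative to the boundary preserves the twisting of an arc. -/
theorem twist_eq_of_homotopy {f : C(I, Annulus)} (hf0 : (f 0).2 = 0) (hf1 : (f 1).2 = 1)
    {H : C(Annulus × I, Annulus)} (hH0 : ∀ x, H (x, 0) = x)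
    (hHbd : ∀ (x : Annulus) (t : I), (x.2 = 0 ∨ x.2 = 1) → H (x, t) = x)
    {w w' : C(Annulus, ℝ)} {b b' : ℝ} (h0 : ∀ z, w (z, 0) = 0) (h1 : ∀ z, w (z, 1) = b)
    (h0' : ∀ z, w' (z, 0) = 0) (h1' : ∀ z, w' (z, 1) = b') {S : Set Circle1} (hS : S.Finite)
    (hw : ∀ t, (f t).1 + (w (f t) : Circle1) ∈ S)
    (hw' : ∀ t, (H (f t, 1)).1 + (w' (H (f t, 1)) : Circle1) ∈ S) : b = b' := by
  obtain ⟨L, hL⟩ := (AddCircle.isCoveringMap_coe 1).exists_lift_square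
    QuotientAddGroup.mk_surjective
    (⟨fun q => (H (f q.1, q.2)).1, by fun_prop⟩ : C(I × I, Circle1))
  replace hL : ∀ t s, (L (t, s) : Circle1) = (H (f t, s)).1 := fun t s => hL (t, s)
  have hfst : ∀ {t : I}, ((f t).2 = 0 ∨ (f t).2 = 1) → L (t, 0) = L (t, 1) := fun {t} ht =>
    (AddCircle.isCoveringMap_coe 1).const_of_comp (g := fun s => L (t, s)) (by fun_prop)
      (fun s s' => (hL t s).trans ((congrArg Prod.fst
        ((hHbd _ s ht).trans (hHbd _ s' ht).symm)).trans (hL t s').symm)) 0 1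
  have hbot : f 0 = ((f 0).1, 0) := Prod.ext rfl hf0
  have htop : f 1 = ((f 1).1, 1) := Prod.ext rfl hf1
  have e := eq_of_coe_mem_finite ⟨fun t => L (t, 0) + w (f t), by fun_prop⟩ hS (fun t => by
    simpa [hL, hH0] using hw t) 0 1
  have e' := eq_of_coe_mem_finite ⟨fun t => L (t, 1) + w' (H (f t, 1)), by fun_prop⟩ hS (fun t => by
    simpa [hL] using hw' t) 0 1
  simp only [ContinuousMap.coe_mk] at e e'
  rw [hHbd _ _ (Or.inl hf0), hHbd _ _ (Or.inr hf1)] at e'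
  rw [hbot, htop, h0, h1] at e
  rw [hbot, htop, h0', h1'] at e'
  have := hfst (Or.inl hf0)
  have := hfst (Or.inr hf1)
  linarith

end Lifting

/-- Each arc of `m` lies in the `ε`-neighbourhood of the corresponding level of
`p ↦ p.1 + w p`. -/
def IsNear {ℓ : ℕ} (w : C(Annulus, ℝ)) (ε : ℝ) (θ : Fin ℓ → Circle1)
    (m : Fin ℓ → Set Annulus) : Prop :=
  ∀ i, ∀ p ∈ m i, ‖p.1 + (w p : Circle1) - θ i‖ < ε

theorem IsNear.disjoint {ℓ : ℕ} {w w' : C(Annulus, ℝ)} {ε : ℝ} {θ σ : Fin ℓ → Circle1}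
    {m m' : Fin ℓ → Set Annulus} (h : IsNear w ε θ m) (h' : IsNear w' ε σ m')
    (hw : ∀ p, |w p - w' p| ≤ ε) {i j : Fin ℓ} (hij : 3 * ε ≤ ‖θ i - σ j‖) :
    Disjoint (m i) (m' j) := by
  refine disjoint_left.2 fun p hp hp' => ?_
  have h1 := h i p hp
  have h2 := h' j p hp'
  have h3 := (circle1_norm_coe_le (w p - w' p)).trans (hw p)
  have e : θ i - σ j = -(p.1 + (w p : Circle1) - θ i) + ((w p - w' p : ℝ) : Circle1) +
      (p.1 + (w' p : Circle1) - σ j) := by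
    rw [AddCircle.coe_sub]
    abel
  have h4 := norm_add₃_le (a := -(p.1 + (w p : Circle1) - θ i))
    (b := ((w p - w' p : ℝ) : Circle1)) (c := p.1 + (w' p : Circle1) - σ j)
  rw [← e, norm_neg] at h4
  linarith

theorem exists_isNear {ℓ : ℕ} {θ : Fin ℓ → Circle1} (w : C(Annulus, ℝ)) {b : ℤ}
    (h0 : ∀ z, w (z, 0) = 0) (h1 : ∀ z, w (z, 1) = b) {ε : ℝ} (hε : 0 < ε)
    (hθ : ∀ i j, i ≠ j → 3 * ε ≤ ‖θ i - θ j‖) : ∃ m, IsMultiarc θ m ∧ IsNear w ε θ m := by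
  choose m hm hnear using fun i => exists_isVertArcSet w h0 h1 (θ i) hε
  exact ⟨m, ⟨hm, fun i j hij => IsNear.disjoint (m := m) (m' := m) hnear hnear
    (fun p => by simpa using hε.le) (hθ i j hij)⟩, hnear⟩

theorem exists_gap {S : Set Circle1} (hS : S.Finite) :
    ∃ ε > 0, ∀ x ∈ S, ∀ y ∈ S, x ≠ y → 3 * ε ≤ ‖x - y‖ := by
  rcases S.subsingleton_or_nontrivial with h | h
  · exact ⟨1, one_pos, fun x hx y hy hxy => absurd (h hx hy) hxy⟩
  · refine ⟨S.infsep / 3, by have := hS.infsep_pos_iff_nontrivial.2 h; positivity,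
      fun x hx y hy hxy => ?_⟩
    have := infsep_le_dist_of_mem hx hy hxy
    rw [dist_eq_norm] at this
    linarith

theorem multiGraph_adj_of_disjoint {ℓ : ℕ} {θ σ : Fin ℓ → Circle1} {a b : MultiVert θ σ}
    (i₀ : Fin ℓ) (h : ∀ i j, Disjoint (a.val i) (b.val j)) : (multiGraph θ σ).Adj a b := by
  refine (SimpleGraph.fromRel_adj _ _ _).2 ⟨?_, Or.inl (by simpa using fun j i => h i j)⟩
  rintro rfl
  have hne : (a.val i₀).Nonempty := by
    rcases a.2 with ha | ha <;> obtain ⟨f, -, hf, -⟩ := ha.1 i₀ <;>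
      exact hf ▸ range_nonempty f
  exact hne.ne_empty (disjoint_self.1 (h i₀ i₀))

/-- Let `A = S¹ × I`, let `θ₁, …, θ_ℓ` and `σ₁, …, σ_ℓ` be distinct
points of `S¹` with `σ i ≠ θ j` for all `i, j`, and let `G` be the graph on `θ`- and
`σ`-multiarcs with edges given by disjointness.  If `α` and `β` are `θ`-multiarcs related
by a homotopy of `A` relative to the boundary, then `α` and `β` lie in the same connected
component of `G`. -/
theorem stmt5 (ℓ : ℕ) (θ σ : Fin ℓ → Circle1)
    (hθ : Function.Injective θ) (hσ : Function.Injective σ)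
    (hθσ : ∀ i j, σ i ≠ θ j)
    (α β : MultiVert θ σ)
    (hα : IsMultiarc θ α.val) (hβ : IsMultiarc θ β.val)
    (H : C(Annulus × unitInterval, Annulus))
    (hH0 : ∀ x : Annulus, H (x, 0) = x)
    (hHbd : ∀ (x : Annulus) (t : unitInterval), (x.2 = 0 ∨ x.2 = 1) → H (x, t) = x)
    (hH1 : (fun x => H (x, 1)) '' (⋃ i, α.val i) = ⋃ i, β.val i) :
    (multiGraph θ σ).Reachable α β := by
  rcases isEmpty_or_nonempty (Fin ℓ) with _ | ⟨⟨i₀⟩⟩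
  · rw [Subtype.ext (Subsingleton.elim α.val β.val)]
  obtain ⟨w, b, hw0, hw1, hw⟩ := hα.exists_potential i₀
  obtain ⟨w', b', hw0', hw1', hw'⟩ := hβ.exists_potential i₀
  have hb : b = b' := by
    obtain ⟨f, -, hf, hf0, hf1, -⟩ := hα.1 i₀
    have hfm : ∀ t, f t ∈ α.val i₀ := fun t => hf ▸ mem_range_self t
    refine Int.cast_injective (α := ℝ) (twist_eq_of_homotopy (f := f) (by rw [hf0]) (by rw [hf1])
      hH0 hHbd hw0 hw1 hw0' hw1' (finite_range θ) (fun t => ⟨i₀, (hw i₀ _ (hfm t)).symm⟩)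
      fun t => ?_)
    obtain ⟨j, hj⟩ := mem_iUnion.1 (hH1 ▸ mem_image_of_mem _ (mem_iUnion.2 ⟨i₀, hfm t⟩) :
      H (f t, 1) ∈ ⋃ i, β.val i)
    exact ⟨j, (hw' j _ hj).symm⟩
  subst hb
  obtain ⟨ε, hε, hgap⟩ := exists_gap ((finite_range θ).union (finite_range σ))
  have hθθ : ∀ i j, i ≠ j → 3 * ε ≤ ‖θ i - θ j‖ := fun i j hij =>
    hgap _ (Or.inl ⟨i, rfl⟩) _ (Or.inl ⟨j, rfl⟩) (hθ.ne hij)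
  have hσσ : ∀ i j, i ≠ j → 3 * ε ≤ ‖σ i - σ j‖ := fun i j hij =>
    hgap _ (Or.inr ⟨i, rfl⟩) _ (Or.inr ⟨j, rfl⟩) (hσ.ne hij)
  have hsep : ∀ i j, 3 * ε ≤ ‖θ i - σ j‖ := fun i j =>
    hgap _ (Or.inl ⟨i, rfl⟩) _ (Or.inr ⟨j, rfl⟩) (hθσ j i).symm
  have hstep : ∀ {u v : C(Annulus, ℝ)}, (∀ z, v (z, 0) = 0) → (∀ z, v (z, 1) = b) →
      (∀ p, |u p - v p| ≤ ε) → ∀ {a c : MultiVert θ σ}, IsNear u ε θ a.val →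
      IsNear v ε θ c.val → (multiGraph θ σ).Reachable a c := by
    intro u v hv0 hv1 huv a c ha hc
    obtain ⟨m, hm, hmv⟩ := exists_isNear v hv0 hv1 hε hσσ
    let d : MultiVert θ σ := ⟨m, Or.inr hm⟩
    have had : (multiGraph θ σ).Adj a d :=
      multiGraph_adj_of_disjoint i₀ fun i j => ha.disjoint hmv huv (hsep i j)
    have hcd : (multiGraph θ σ).Adj c d :=
      multiGraph_adj_of_disjoint i₀ fun i j =>
        hc.disjoint hmv (fun p => by simpa using hε.le) (hsep i j)
    exact had.reachable.trans hcd.symm.reachable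
  obtain ⟨N, hN⟩ := exists_nat_ge (‖w' - w‖ / ε)
  let W : ℕ → C(Annulus, ℝ) := fun k => w + ((k : ℝ) / (N + 1)) • (w' - w)
  have hW : ∀ k p, |W k p - W (k + 1) p| ≤ ε := fun k p => by
    have hp : |w' p - w p| ≤ ‖w' - w‖ := (w' - w).norm_coe_le_norm p
    have hd : W k p - W (k + 1) p = -((w' p - w p) / (N + 1)) := by
      simp only [W, ContinuousMap.add_apply, ContinuousMap.smul_apply, ContinuousMap.sub_apply,
        smul_eq_mul, Nat.cast_add, Nat.cast_one]
      ring
    have hN0 : (0 : ℝ) < N + 1 := by positivity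
    rw [hd, abs_neg, abs_div, abs_of_pos hN0, div_le_iff₀ hN0]
    rw [div_le_iff₀ hε] at hN
    nlinarith
  have hWbot : ∀ k z, W k (z, 0) = 0 := fun k z => by simp [W, hw0, hw0']
  have hWtop : ∀ k z, W k (z, 1) = b := fun k z => by simp [W, hw1, hw1']
  have hreach : ∀ k, ∀ c : MultiVert θ σ, IsNear (W k) ε θ c.val →
      (multiGraph θ σ).Reachable α c := by
    intro k
    induction k with
    | zero =>
      intro c hc
      have hα0 : IsNear (W 0) ε θ α.val := fun i p hp => by simpa [W, hw i p hp] using hε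
      exact hstep (hWbot 0) (hWtop 0) (fun p => by simpa using hε.le) hα0 hc
    | succ k ih =>
      intro c hc
      obtain ⟨m, hm, hmk⟩ := exists_isNear (W k) (hWbot k) (hWtop k) hε hθθ
      exact (ih ⟨m, Or.inl hm⟩ hmk).trans
        (hstep (hWbot (k + 1)) (hWtop (k + 1)) (hW k) (a := ⟨m, Or.inl hm⟩) hmk hc)
  have hWN : W (N + 1) = w' := by
    have hN0 : (N + 1 : ℝ) ≠ 0 := by positivity
    simp [W, div_self hN0]
  refine hreach (N + 1) β fun i p hp => ?_
  rw [hWN, hw' i p hp, sub_self, norm_zero]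
  exact hε
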